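/- Gasharov's persistence for modules: let k be a field, S = k[x_0,…,x_n] with the standard grading, F a free graded S-module all of whose generators have degree at most l, N a graded submodule of F, and M = F/N. Let p ≥ 0 and d ≥ p + l + 1 be integers. If N is generated in degrees at most d and H(M, d+1) = H(M, d)^{⟨d − l − p⟩}, then H(M, d+2) = H(M, d+1)^{⟨d + 1 − l − p⟩}. -/

import Mathlib

/-- The `d`-th Macaulay transform `a^{⟨d⟩}`: writing the (unique, greedy) `d`-th Macaulay
representation `a = C(k_d, d) + C(k_{d-1}, d-1) + ⋯ + C(k_δ, δ)` with
`k_d > k_{d-1} > ⋯ > k_δ ≥ δ ≥ 1`, it is `C(k_d+1, d+1) + ⋯ + C(k_δ+1, δ+1)`;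
by convention `0^{⟨d⟩} = 0`. -/
def macaulayTransform : ℕ → ℕ → ℕ
  | 0, _ => 0
  | _ + 1, 0 => 0
  | d + 1, a + 1 =>
    Nat.choose (Nat.findGreatest (fun k => Nat.choose k (d + 1) ≤ a + 1) (a + d + 2) + 1) (d + 2)
      + macaulayTransform d
          (a + 1 - Nat.choose (Nat.findGreatest (fun k => Nat.choose k (d + 1) ≤ a + 1) (a + d + 2)) (d + 1))

/-- The degree-`e` graded piece of `S = k[x_0, …, x_n]` (zero in negative degrees). -/
noncomputable def degPiece (K : Type) [Field K] (n : ℕ) (e : ℤ) :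
    Submodule K (MvPolynomial (Fin (n+1)) K) :=
  if 0 ≤ e then MvPolynomial.homogeneousSubmodule (Fin (n+1)) K e.toNat else ⊥

/-- The degree-`m` graded piece of the free module `F = S e_1 ⊕ ⋯ ⊕ S e_r` with
`deg e_i = f i`; its `i`-th coordinate is the degree-`(m - f i)` piece of `S`. -/
noncomputable def freeDegPiece (K : Type) [Field K] (n r : ℕ) (f : Fin r → ℤ) (m : ℤ) :
    Submodule K (Fin r → MvPolynomial (Fin (n+1)) K) :=
  Submodule.pi Set.univ (fun i => degPiece K n (m - f i))

/-- The Hilbert function `H(F/N, m) = dim_k F_m - dim_k (N ∩ F_m)` of the quotient of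
`F = S e_1 ⊕ ⋯ ⊕ S e_r` by a (graded) submodule `N`. -/
noncomputable def hilbFn (K : Type) [Field K] (n r : ℕ) (f : Fin r → ℤ)
    (N : Submodule (MvPolynomial (Fin (n+1)) K) (Fin r → MvPolynomial (Fin (n+1)) K))
    (m : ℤ) : ℕ :=
  Module.finrank K (freeDegPiece K n r f m) -
  Module.finrank K
    (N.restrictScalars K ⊓ freeDegPiece K n r f m :
      Submodule K (Fin r → MvPolynomial (Fin (n+1)) K))

/-- The lower Macaulay transform `a_{⟨d⟩} = C(k_d - 1, d) + ⋯ + C(k_δ - 1, δ)`. -/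
def macaulayLower : ℕ → ℕ → ℕ
  | 0, _ => 0
  | d + 1, a =>
    Nat.choose (Nat.findGreatest (fun k => Nat.choose k (d + 1) ≤ a) (a + d + 1) - 1) (d + 1)
      + macaulayLower d
          (a - Nat.choose (Nat.findGreatest (fun k => Nat.choose k (d + 1) ≤ a) (a + d + 1)) (d + 1))

theorem le_add_choose_succ (k d : ℕ) : k ≤ d + Nat.choose k (d + 1) := by
  induction k with
  | zero => omega
  | succ k ih =>
    rw [Nat.choose_succ_succ']
    rcases Nat.lt_or_ge k d with h | h
    · omega
    · have := Nat.choose_pos h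
      omega

theorem exists_choose_le_lt (d a : ℕ) :
    ∃ k, Nat.choose k (d + 1) ≤ a ∧ a < Nat.choose (k + 1) (d + 1) := by
  have hex : ∃ k, a < Nat.choose (k + 1) (d + 1) :=
    ⟨a + d, by have := le_add_choose_succ (a + d + 1) d; omega⟩
  classical
  refine ⟨Nat.find hex, ?_, Nat.find_spec hex⟩
  rcases hk : Nat.find hex with _ | k
  · simp
  · exact not_lt.1 (Nat.find_min hex (by omega : k < Nat.find hex))

theorem choose_lt_imp_lt {d j k : ℕ} (h : Nat.choose j d < Nat.choose k d) : j < k := by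
  by_contra hjk
  exact absurd (Nat.choose_le_choose d (not_lt.1 hjk)) (not_le.2 h)

theorem findGreatest_choose_eq {d a k B : ℕ} (h₁ : Nat.choose k (d + 1) ≤ a)
    (h₂ : a < Nat.choose (k + 1) (d + 1)) (hB : a + d ≤ B) :
    Nat.findGreatest (fun k => Nat.choose k (d + 1) ≤ a) B = k := by
  rw [Nat.findGreatest_eq_iff]
  refine ⟨?_, fun _ => h₁, fun m hm _ => not_le.2 (h₂.trans_le (Nat.choose_le_choose _ hm))⟩
  have := le_add_choose_succ k d
  omega

theorem macaulayLower_succ {d a k : ℕ} (h₁ : Nat.choose k (d + 1) ≤ a)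
    (h₂ : a < Nat.choose (k + 1) (d + 1)) :
    macaulayLower (d + 1) a =
      Nat.choose (k - 1) (d + 1) + macaulayLower d (a - Nat.choose k (d + 1)) := by
  rw [macaulayLower, findGreatest_choose_eq h₁ h₂ (by omega)]

theorem macaulayTransform_zero (d : ℕ) : macaulayTransform d 0 = 0 := by
  cases d <;> simp [macaulayTransform]

theorem macaulayTransform_succ {d a k : ℕ} (h₁ : Nat.choose k (d + 1) ≤ a)
    (h₂ : a < Nat.choose (k + 1) (d + 1)) :
    macaulayTransform (d + 1) a =
      Nat.choose (k + 1) (d + 1 + 1) + macaulayTransform d (a - Nat.choose k (d + 1)) := by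
  rcases a with _ | a
  · have hk : k ≤ d := by
      by_contra hk
      have : 0 < Nat.choose k (d + 1) := Nat.choose_pos (not_le.1 hk)
      omega
    rw [macaulayTransform_zero, Nat.choose_eq_zero_of_lt (by omega : k + 1 < d + 1 + 1),
      Nat.zero_sub, macaulayTransform_zero]
  · rw [macaulayTransform, findGreatest_choose_eq h₁ h₂ (by omega)]

theorem macaulayLower_zero (d : ℕ) : macaulayLower d 0 = 0 := by
  induction d with
  | zero => rfl
  | succ d ih =>
    rw [macaulayLower_succ (k := d) (by simp) (by simp),
      Nat.choose_eq_zero_of_lt (by omega : d - 1 < d + 1), Nat.zero_sub, ih]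

theorem macaulayLower_one (a : ℕ) : macaulayLower 1 a = a - 1 := by
  rw [macaulayLower_succ (k := a) (by simp) (by simp)]
  simp [macaulayLower]

theorem choose_pred_add {k d : ℕ} (hk : d + 1 ≤ k) :
    Nat.choose (k - 1) (d + 1) + Nat.choose (k - 1) d = Nat.choose k (d + 1) := by
  obtain ⟨k, rfl⟩ := Nat.exists_eq_add_of_le' (by omega : 1 ≤ k)
  rw [Nat.add_sub_cancel, Nat.choose_succ_succ', add_comm]

theorem eq_zero_of_lt_choose {d a k : ℕ} (h₁ : Nat.choose k (d + 1) ≤ a)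
    (h₂ : a < Nat.choose (k + 1) (d + 1)) : d + 1 ≤ k ∨ (a = 0 ∧ k = d) := by
  by_contra h
  rcases Nat.lt_trichotomy k d with hk | hk | hk
  · rw [Nat.choose_eq_zero_of_lt (by omega)] at h₂
    omega
  · subst hk
    simp at h₂
    omega
  · omega

theorem macaulayLower_lt {d k a : ℕ} (hk : d + 1 ≤ k) (ha : a < Nat.choose k d) :
    macaulayLower d a < Nat.choose (k - 1) d := by
  induction d generalizing k a with
  | zero => simp [macaulayLower]
  | succ d ih =>
    obtain ⟨j, h₁, h₂⟩ := exists_choose_le_lt d a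
    rcases eq_zero_of_lt_choose h₁ h₂ with hj | ⟨rfl, rfl⟩
    · rw [macaulayLower_succ h₁ h₂]
      have hjk : j < k := choose_lt_imp_lt (h₁.trans_lt ha)
      rw [Nat.choose_succ_succ'] at h₂
      have := ih hj (a := a - Nat.choose j (d + 1)) (by omega)
      have := choose_pred_add hj
      have := Nat.choose_le_choose (d + 1) (by omega : j ≤ k - 1)
      omega
    · rw [macaulayLower_zero]
      exact Nat.choose_pos (by omega)

theorem macaulayLower_choose (d k : ℕ) (hd : 1 ≤ d) :
    macaulayLower d (Nat.choose k d) = Nat.choose (k - 1) d := by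
  obtain ⟨d, rfl⟩ := Nat.exists_eq_add_of_le' hd
  rcases Nat.lt_or_ge k d with h | h
  · rw [Nat.choose_eq_zero_of_lt (by omega), Nat.choose_eq_zero_of_lt (by omega),
      macaulayLower_zero]
  · rw [macaulayLower_succ le_rfl, Nat.sub_self, macaulayLower_zero, add_zero]
    rw [Nat.choose_succ_succ']
    have := Nat.choose_pos h
    omega

theorem macaulayLower_le_succ (d a : ℕ) : macaulayLower d a ≤ macaulayLower d (a + 1) := by
  induction d generalizing a with
  | zero => simp [macaulayLower]
  | succ d ih =>
    obtain ⟨k, h₁, h₂⟩ := exists_choose_le_lt d a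
    rcases Nat.lt_or_ge (a + 1) (Nat.choose (k + 1) (d + 1)) with h | h
    · rw [macaulayLower_succ h₁ h₂, macaulayLower_succ (by omega) h,
        Nat.sub_add_comm h₁]
      have := ih (a - Nat.choose k (d + 1))
      omega
    · rcases eq_zero_of_lt_choose h₁ h₂ with hk | ⟨rfl, rfl⟩
      · obtain rfl | hd := Nat.eq_zero_or_pos d
        · simp [macaulayLower_one]
        · have h : a + 1 = Nat.choose (k + 1) (d + 1) := by omega
          have := macaulayLower_choose (d + 1) (k + 1) (by omega)
          rw [h, this, macaulayLower_succ h₁ h₂]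
          rw [Nat.choose_succ_succ'] at h
          have := macaulayLower_lt (a := a - Nat.choose k (d + 1)) hk (by omega)
          have := choose_pred_add hk
          simp only [Nat.add_sub_cancel]
          omega
      · simp [macaulayLower_zero]

theorem macaulayLower_mono (d : ℕ) : Monotone (macaulayLower d) :=
  monotone_nat_of_le_succ (macaulayLower_le_succ d)

theorem macaulayLower_succ_le (d a : ℕ) : macaulayLower d (a + 1) ≤ macaulayLower d a + 1 := by
  induction d generalizing a with
  | zero => simp [macaulayLower]
  | succ d ih =>
    obtain ⟨k, h₁, h₂⟩ := exists_choose_le_lt d a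
    rcases Nat.lt_or_ge (a + 1) (Nat.choose (k + 1) (d + 1)) with h | h
    · rw [macaulayLower_succ h₁ h₂, macaulayLower_succ (by omega) h,
        Nat.sub_add_comm h₁]
      have := ih (a - Nat.choose k (d + 1))
      omega
    · obtain rfl | hd := Nat.eq_zero_or_pos d
      · simp only [zero_add, macaulayLower_one]
        omega
      · have h : a + 1 = Nat.choose (k + 1) (d + 1) := by omega
        have := macaulayLower_choose (d + 1) (k + 1) (by omega)
        rw [h, this, macaulayLower_succ h₁ h₂]
        simp only [Nat.add_sub_cancel]
        rcases eq_zero_of_lt_choose h₁ h₂ with hk | ⟨rfl, rfl⟩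
        · rw [Nat.choose_succ_succ'] at h
          have := ih (a - Nat.choose k (d + 1))
          rw [show a - Nat.choose k (d + 1) + 1 = Nat.choose k d by omega,
            macaulayLower_choose d k hd] at this
          have := choose_pred_add hk
          omega
        · simp

theorem macaulayLower_add_le (d a t : ℕ) :
    macaulayLower d (a + t) ≤ macaulayLower d a + t := by
  induction t with
  | zero => simp
  | succ t ih =>
    have := macaulayLower_succ_le d (a + t)
    rw [← add_assoc]
    omega

theorem macaulayLower_le (d a : ℕ) : macaulayLower d a ≤ a := by
  simpa [macaulayLower_zero] using macaulayLower_add_le d 0 a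

theorem macaulayLower_lt_self {d a : ℕ} (ha : 0 < a) : macaulayLower d a < a := by
  rcases d with _ | d
  · simpa [macaulayLower] using ha
  · obtain ⟨k, h₁, h₂⟩ := exists_choose_le_lt d a
    rcases eq_zero_of_lt_choose h₁ h₂ with hk | ⟨rfl, rfl⟩
    · have h := macaulayLower_add_le (d + 1) (Nat.choose k (d + 1)) (a - Nat.choose k (d + 1))
      rw [macaulayLower_choose _ _ (by omega), Nat.add_sub_cancel' h₁] at h
      have := choose_pred_add hk
      have := Nat.choose_pos (by omega : d ≤ k - 1)
      omega
    · omega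

theorem macaulayTransform_lt {d k a : ℕ} (ha : a < Nat.choose k d) :
    macaulayTransform d a < Nat.choose (k + 1) (d + 1) := by
  induction d generalizing k a with
  | zero => simp [macaulayTransform]
  | succ d ih =>
    obtain ⟨j, h₁, h₂⟩ := exists_choose_le_lt d a
    have hjk : j < k := choose_lt_imp_lt (h₁.trans_lt ha)
    rw [Nat.choose_succ_succ'] at h₂
    have := ih (k := j) (a := a - Nat.choose j (d + 1)) (by omega)
    rw [macaulayTransform_succ h₁ (by rw [Nat.choose_succ_succ']; exact h₂)]
    refine lt_of_lt_of_le ?_ (Nat.choose_le_choose _ (by omega : j + 1 + 1 ≤ k + 1))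
    rw [Nat.choose_succ_succ' (j + 1)]
    omega

theorem macaulayTransform_mono (d : ℕ) : Monotone (macaulayTransform d) := by
  induction d with
  | zero => intro a b _; simp [macaulayTransform]
  | succ d ih =>
    intro a b hab
    obtain ⟨j, h₁, h₂⟩ := exists_choose_le_lt d a
    obtain ⟨k, h₃, h₄⟩ := exists_choose_le_lt d b
    have hjk : j < k + 1 := choose_lt_imp_lt (h₁.trans_lt (hab.trans_lt h₄))
    rcases Nat.lt_or_ge j k with h | h
    · rw [macaulayTransform_succ h₃ h₄]
      have h₅ := macaulayTransform_lt h₂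
      have := Nat.choose_le_choose (d + 1 + 1) (by omega : j + 1 + 1 ≤ k + 1)
      omega
    · obtain rfl : j = k := by omega
      rw [macaulayTransform_succ h₁ h₂, macaulayTransform_succ h₃ h₄]
      have := ih (Nat.sub_le_sub_right hab (Nat.choose j (d + 1)))
      omega

theorem macaulayTransform_eq_add_of_lt {d k a : ℕ} (ha : a < Nat.choose k d) :
    macaulayTransform d a = a + macaulayTransform d (macaulayLower d a) := by
  induction d generalizing k a with
  | zero => simp [macaulayTransform] at ha ⊢; omega
  | succ d ih =>
    obtain ⟨j, h₁, h₂⟩ := exists_choose_le_lt d a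
    rcases eq_zero_of_lt_choose h₁ h₂ with hj | ⟨rfl, rfl⟩
    · have h₃ : a - Nat.choose j (d + 1) < Nat.choose j d := by
        rw [Nat.choose_succ_succ'] at h₂
        omega
      have h₄ := macaulayLower_lt hj h₃
      rw [macaulayTransform_succ h₁ h₂, macaulayLower_succ h₁ h₂, ih h₃,
        macaulayTransform_succ (k := j - 1) (by omega) ?_]
      · rw [Nat.add_sub_cancel_left, Nat.choose_succ_succ' j,
          Nat.sub_add_cancel (by omega : 1 ≤ j)]
        omega
      · rw [Nat.sub_add_cancel (by omega : 1 ≤ j)]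
        have := choose_pred_add hj
        omega
    · simp [macaulayTransform_zero, macaulayLower_zero]

theorem macaulayTransform_eq_add {d : ℕ} (hd : 1 ≤ d) (a : ℕ) :
    macaulayTransform d a = a + macaulayTransform d (macaulayLower d a) := by
  obtain ⟨d, rfl⟩ := Nat.exists_eq_add_of_le' hd
  obtain ⟨k, -, h⟩ := exists_choose_le_lt d a
  exact macaulayTransform_eq_add_of_lt h

theorem macaulayLower_macaulayTransform_of_lt {d k a : ℕ} (ha : a < Nat.choose k d) :
    macaulayLower (d + 1) (macaulayTransform d a) =
      macaulayTransform d (macaulayLower d a) := by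
  induction d generalizing k a with
  | zero => simp [macaulayTransform, macaulayLower_zero]
  | succ d ih =>
    obtain ⟨j, h₁, h₂⟩ := exists_choose_le_lt d a
    rcases eq_zero_of_lt_choose h₁ h₂ with hj | ⟨rfl, rfl⟩
    · have h₃ : a - Nat.choose j (d + 1) < Nat.choose j d := by
        rw [Nat.choose_succ_succ'] at h₂
        omega
      have h₄ := macaulayLower_lt hj h₃
      have h₅ := macaulayTransform_lt h₃
      rw [macaulayTransform_succ h₁ h₂, macaulayLower_succ h₁ h₂,
        macaulayTransform_succ (k := j - 1) (by omega) ?_,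
        macaulayLower_succ (k := j + 1) (by omega) ?_]
      · rw [Nat.add_sub_cancel_left, Nat.add_sub_cancel_left, ih h₃,
          Nat.sub_add_cancel (by omega : 1 ≤ j)]
        rfl
      · rw [Nat.choose_succ_succ' (j + 1)]
        omega
      · rw [Nat.sub_add_cancel (by omega : 1 ≤ j)]
        have := choose_pred_add hj
        omega
    · simp [macaulayTransform_zero, macaulayLower_zero]

theorem macaulayLower_macaulayTransform {d : ℕ} (hd : 1 ≤ d) (a : ℕ) :
    macaulayLower (d + 1) (macaulayTransform d a) =
      macaulayTransform d (macaulayLower d a) := by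
  obtain ⟨d, rfl⟩ := Nat.exists_eq_add_of_le' hd
  obtain ⟨k, -, h⟩ := exists_choose_le_lt d a
  exact macaulayLower_macaulayTransform_of_lt h

theorem le_macaulayTransform_of_lt {d k a b : ℕ} (ha : a < Nat.choose k d)
    (h : b ≤ a + macaulayLower (d + 1) b) : b ≤ macaulayTransform d a := by
  induction d generalizing k a b with
  | zero => simp [macaulayTransform, macaulayLower_one] at *; omega
  | succ d ih =>
    obtain ⟨k, h₁, h₂⟩ := exists_choose_le_lt d a
    obtain ⟨j, h₃, h₄⟩ := exists_choose_le_lt (d + 1) b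
    rw [macaulayTransform_succ h₁ h₂]
    have h₅ : a - Nat.choose k (d + 1) < Nat.choose k d := by
      rw [Nat.choose_succ_succ'] at h₂
      omega
    rcases eq_zero_of_lt_choose h₃ h₄ with hj | ⟨rfl, rfl⟩
    · rcases Nat.lt_trichotomy j (k + 1) with hjk | rfl | hjk
      · have := Nat.choose_le_choose (d + 1 + 1) (by omega : j + 1 ≤ k + 1)
        omega
      · rw [macaulayLower_succ h₃ h₄, Nat.add_sub_cancel] at h
        have h₆ := Nat.choose_succ_succ' k (d + 1)
        have := ih h₅ (b := b - Nat.choose (k + 1) (d + 1 + 1)) (by omega)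
        omega
      · exfalso
        rw [macaulayLower_succ h₃ h₄] at h
        have h₆ := choose_pred_add hj
        have := Nat.choose_le_choose (d + 1) (by omega : k + 1 ≤ j - 1)
        have := macaulayLower_le (d + 1) (b - Nat.choose j (d + 1 + 1))
        omega
    · omega

theorem le_macaulayTransform {d a b : ℕ} (hd : 1 ≤ d)
    (h : b ≤ a + macaulayLower (d + 1) b) : b ≤ macaulayTransform d a := by
  obtain ⟨d, rfl⟩ := Nat.exists_eq_add_of_le' hd
  obtain ⟨k, -, ha⟩ := exists_choose_le_lt d a
  exact le_macaulayTransform_of_lt ha h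

theorem le_macaulayLower {d b c : ℕ} (hbc : b ≤ c)
    (h : b ≤ macaulayLower (d + 1) b + macaulayLower d (c - b)) :
    b ≤ macaulayLower (d + 1) c := by
  induction d generalizing b c with
  | zero =>
    rw [zero_add, macaulayLower_one] at h ⊢
    simp only [macaulayLower] at h
    omega
  | succ d ih =>
    obtain ⟨k, h₁, h₂⟩ := exists_choose_le_lt (d + 1) c
    rcases eq_zero_of_lt_choose h₁ h₂ with hk | ⟨rfl, rfl⟩
    swap
    · omega
    obtain ⟨m, rfl⟩ := Nat.exists_eq_add_of_le' (by omega : 2 ≤ k)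
    change Nat.choose (m + 1 + 1) (d + 1 + 1) ≤ c at h₁
    change c < Nat.choose (m + 1 + 1 + 1) (d + 1 + 1) at h₂
    have p₁ := Nat.choose_succ_succ' (m + 1 + 1) (d + 1)
    have p₂ := Nat.choose_succ_succ' (m + 1) (d + 1)
    have p₃ := Nat.choose_succ_succ' m (d + 1)
    have p₄ := Nat.choose_succ_succ' (m + 1) d
    have p₅ := Nat.choose_succ_succ' m d
    obtain ⟨c', rfl⟩ := Nat.exists_eq_add_of_le h₁
    have hc := macaulayLower_succ h₁ h₂
    rw [Nat.add_sub_cancel_left, Nat.add_sub_cancel] at hc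
    rw [hc]
    rcases Nat.lt_or_ge b (Nat.choose (m + 1) (d + 1 + 1)) with hb | hb
    · omega
    rcases Nat.lt_or_ge b (Nat.choose (m + 1 + 1) (d + 1 + 1)) with hb' | hb'
    · rw [macaulayLower_succ hb hb', Nat.add_sub_cancel] at h
      obtain ⟨b', rfl⟩ := Nat.exists_eq_add_of_le hb
      rw [Nat.add_sub_cancel_left] at h
      rcases Nat.lt_or_ge c' b' with hcb | hcb
      · have h₃ := macaulayLower_mono (d + 1) (by omega :
          Nat.choose (m + 1 + 1) (d + 1 + 1) + c' - (Nat.choose (m + 1) (d + 1 + 1) + b') ≤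
            Nat.choose (m + 1) (d + 1))
        rw [macaulayLower_choose _ _ (by omega), Nat.add_sub_cancel] at h₃
        have := macaulayLower_lt_self (d := d + 1) (by omega : 0 < b')
        omega
      · rw [show Nat.choose (m + 1 + 1) (d + 1 + 1) + c' - (Nat.choose (m + 1) (d + 1 + 1) + b') =
            Nat.choose (m + 1) (d + 1) + (c' - b') by omega] at h
        rcases Nat.lt_or_ge (c' - b') (Nat.choose (m + 1) d) with hcb' | hcb'
        · rw [macaulayLower_succ (d := d) (a := Nat.choose (m + 1) (d + 1) + (c' - b')) (k := m + 1)
              (by omega) (by omega),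
            Nat.add_sub_cancel_left, Nat.add_sub_cancel] at h
          have := ih hcb (by omega)
          omega
        · have h₃ := macaulayLower_add_le (d + 1) c' (Nat.choose (m + 1 + 1) (d + 1) - c')
          rw [Nat.add_sub_cancel' (by omega), macaulayLower_choose _ _ (by omega),
            Nat.add_sub_cancel] at h₃
          omega
    · obtain ⟨b', rfl⟩ := Nat.exists_eq_add_of_le hb'
      rw [macaulayLower_succ hb' (by omega), Nat.add_sub_cancel_left, Nat.add_sub_cancel,
        Nat.add_sub_add_left] at h
      have h₃ := macaulayLower_mono (d + 1) (by omega :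
        c' - b' ≤ Nat.choose (m + 1 + 1) (d + 1))
      rw [macaulayLower_choose _ _ (by omega), Nat.add_sub_cancel] at h₃
      have h₄ := macaulayLower_le (d + 1) b'
      have h₅ := macaulayLower_mono (d + 1) (Nat.sub_le c' b')
      rcases Nat.eq_zero_or_pos b' with rfl | hb₀
      · omega
      · have := macaulayLower_lt_self (d := d + 1) hb₀
        omega

/-- The property `P` holds off a proper hypersurface of the affine space `ι → K`. -/
def Generic {K ι : Type*} [Field K] (P : (ι → K) → Prop) : Prop :=
  ∃ p : MvPolynomial ι K, p ≠ 0 ∧ ∀ v, MvPolynomial.eval v p ≠ 0 → P v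

namespace Generic

variable {K ι : Type*} [Field K] {P Q : (ι → K) → Prop}

theorem of_forall (h : ∀ v, P v) : Generic P := ⟨1, one_ne_zero, fun v _ => h v⟩

theorem mono (hP : Generic P) (h : ∀ v, P v → Q v) : Generic Q := by
  obtain ⟨p, hp, hpP⟩ := hP
  exact ⟨p, hp, fun v hv => h v (hpP v hv)⟩

theorem and (hP : Generic P) (hQ : Generic Q) : Generic fun v => P v ∧ Q v := by
  obtain ⟨p, hp, hpP⟩ := hP
  obtain ⟨q, hq, hqQ⟩ := hQ
  refine ⟨p * q, mul_ne_zero hp hq, fun v hv => ?_⟩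
  rw [map_mul] at hv
  exact ⟨hpP v (left_ne_zero_of_mul hv), hqQ v (right_ne_zero_of_mul hv)⟩

theorem exists_of_infinite [Infinite K] (hP : Generic P) : ∃ v, P v := by
  obtain ⟨p, hp, hpP⟩ := hP
  by_contra! h
  exact hp (MvPolynomial.funext fun v => by
    rw [map_zero]
    by_contra hv
    exact h v (hpP v hv))

theorem notMem [Fintype ι] {L : Submodule K (ι → K)} (hL : L ≠ ⊤) :
    Generic fun v => v ∉ L := by
  classical
  obtain ⟨φ, hφ, hLφ⟩ := L.exists_le_ker_of_lt_top (lt_top_iff_ne_top.2 hL)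
  have heval (v : ι → K) : MvPolynomial.eval v
      (∑ k, MvPolynomial.X k * MvPolynomial.C (φ (Pi.single k 1))) = φ v := by
    conv_rhs => rw [pi_eq_sum_univ' v]
    simp
  refine ⟨∑ k, MvPolynomial.X k * MvPolynomial.C (φ (Pi.single k 1)), fun h => hφ ?_,
    fun v hv hvL => hv ?_⟩
  · refine LinearMap.ext fun v => ?_
    rw [← heval, h, map_zero, LinearMap.zero_apply]
  · rw [heval]
    exact hLφ hvL

end Generic

section LinearAlgebra

open Module Submodule

variable {K E ι : Type*} [Field K] [AddCommGroup E] [Module K E]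

theorem finrank_map_add_finrank_inf_ker {E' : Type*} [AddCommGroup E'] [Module K E']
    (t : E →ₗ[K] E') (A : Submodule K E) [FiniteDimensional K A] :
    finrank K (A.map t) + finrank K (A ⊓ LinearMap.ker t : Submodule K E) = finrank K A := by
  have h := (t.domRestrict A).finrank_range_add_finrank_ker
  rw [LinearMap.range_domRestrict, LinearMap.ker_domRestrict] at h
  rw [← h, ← map_comap_subtype, (equivMapOfInjective A.subtype A.injective_subtype _).finrank_eq]

theorem finrank_sup_map_add_finrank_inf_comap (t : E →ₗ[K] E) (W A : Submodule K E)
    [FiniteDimensional K W] [FiniteDimensional K A] :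
    finrank K (W ⊔ A.map t : Submodule K E) + finrank K (A ⊓ W.comap t : Submodule K E) =
      finrank K W + finrank K A := by
  have h₁ := finrank_map_add_finrank_inf_ker (W.mkQ.comp t) A
  have h₂ := finrank_map_add_finrank_inf_ker W.mkQ (W ⊔ A.map t)
  rw [Submodule.map_comp, LinearMap.ker_comp, ker_mkQ] at h₁
  rw [Submodule.map_sup, ker_mkQ, mkQ_map_self, bot_sup_eq, inf_eq_right.2 le_sup_left] at h₂
  omega

theorem generic_finrank_le [Fintype ι] (T : (ι → K) →ₗ[K] End K E) (W A : Submodule K E)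
    [FiniteDimensional K W] [FiniteDimensional K A] (v₀ : ι → K) :
    Generic fun v => finrank K (W ⊔ A.map (T v₀) : Submodule K E) ≤
      finrank K (W ⊔ A.map (T v) : Submodule K E) := by
  classical
  set U := W ⊔ A.map (T v₀) with hU
  let b := finBasis K U
  have hb (i) : ∃ w ∈ W, ∃ a ∈ A, w + T v₀ a = b i := by
    obtain ⟨w, hw, x, hx, h⟩ := mem_sup.1 (b i).2
    obtain ⟨a, ha, rfl⟩ := mem_map.1 hx
    exact ⟨w, hw, a, ha, h⟩
  choose w hw a ha hwa using hb
  obtain ⟨π, hπ⟩ := U.subtype.exists_leftInverse_of_injective U.ker_subtype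
  let φ : E →ₗ[K] (Fin (finrank K U) → K) := b.equivFun.toLinearMap ∘ₗ π
  let M : Matrix (Fin (finrank K U)) (Fin (finrank K U)) (MvPolynomial ι K) :=
    Matrix.of fun i j => MvPolynomial.C (φ (w i) j) +
      ∑ k, MvPolynomial.X k * MvPolynomial.C (φ (T (Pi.single k 1) (a i)) j)
  have hM (v : ι → K) : MvPolynomial.eval v M.det =
      (Matrix.of fun i => φ (w i + T v (a i))).det := by
    rw [RingHom.map_det]
    congr 1
    ext i j
    have hv : T v = ∑ k, v k • T (Pi.single k 1) := by
      conv_lhs => rw [pi_eq_sum_univ' v]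
      simp
    simp [M, hv]
  refine ⟨M.det, fun h => ?_, fun v hv => ?_⟩
  · have h₁ := hM v₀
    have : (Matrix.of fun i => φ (w i + T v₀ (a i))) = (1 : Matrix _ _ K) := by
      ext i j
      have : π (b i) = b i := LinearMap.congr_fun hπ (b i)
      simp [hwa, φ, this, Matrix.one_apply, Finsupp.single_apply]
    rw [this, Matrix.det_one, h, map_zero] at h₁
    exact zero_ne_one h₁
  · rw [hM] at hv
    have h₁ := Matrix.linearIndependent_rows_of_det_ne_zero hv
    have h₂ : LinearIndependent K fun i => w i + T v (a i) := LinearIndependent.of_comp φ h₁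
    rw [← finrank_span_eq_card h₂ |>.trans (Fintype.card_fin _)]
    refine finrank_mono (span_le.2 ?_)
    rintro _ ⟨i, rfl⟩
    exact add_mem_sup (hw i) (mem_map_of_mem (ha i))

/-- Finite-dimensional subspaces `F e` of `E` such that `F (e + 1)` is spanned by the images of
`F e` under the commuting operators `T v`. -/
structure GradedAction (T : (ι → K) →ₗ[K] End K E) (F : ℕ → Submodule K E) : Prop where
  comm : ∀ u v x, T u (T v x) = T v (T u x)
  finite : ∀ e, FiniteDimensional K (F e)
  succ : ∀ e, F (e + 1) = map₂ T ⊤ (F e)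

namespace GradedAction

variable {T : (ι → K) →ₗ[K] End K E} {F : ℕ → Submodule K E}

theorem map₂_map₂_le (h : GradedAction T F) (L L' : Submodule K (ι → K)) (A : Submodule K E) :
    map₂ T L (map₂ T L' A) ≤ map₂ T L' (map₂ T L A) := by
  refine map₂_le.2 fun v hv => ?_
  suffices map₂ T L' A ≤ (map₂ T L' (map₂ T L A)).comap (T v) from fun x hx => this hx
  refine map₂_le.2 fun u hu a ha => ?_
  rw [mem_comap, h.comm]
  exact apply_mem_map₂ _ hu (apply_mem_map₂ _ hv ha)

theorem apply_mem_map₂_map (h : GradedAction T F) {L : Submodule K (ι → K)} {A B : Submodule K E}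
    {u : ι → K} (hAB : A.map (T u) ≤ B) {x : E} (hx : x ∈ map₂ T L A) : T u x ∈ map₂ T L B := by
  suffices map₂ T L A ≤ (map₂ T L B).comap (T u) from this hx
  refine map₂_le.2 fun v hv a ha => ?_
  rw [mem_comap, h.comm]
  exact apply_mem_map₂ _ hv (hAB (mem_map_of_mem ha))

theorem map_le (h : GradedAction T F) (e : ℕ) (v : ι → K) : (F e).map (T v) ≤ F (e + 1) := by
  rw [h.succ, map_le_iff_le_comap]
  exact fun x hx => apply_mem_map₂ _ mem_top hx

theorem map₂_le_succ (h : GradedAction T F) (e : ℕ) (L : Submodule K (ι → K)) :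
    map₂ T L (F e) ≤ F (e + 1) := by
  rw [h.succ]
  exact map₂_le_map₂_left le_top

theorem finiteDimensional_of_le (h : GradedAction T F) {e : ℕ} {W : Submodule K E}
    (hW : W ≤ F e) : FiniteDimensional K W :=
  have := h.finite e
  Submodule.finiteDimensional_of_le hW

theorem finrank_mono_of_le (h : GradedAction T F) {e : ℕ} {W W' : Submodule K E}
    (hW' : W' ≤ F e) (hWW' : W ≤ W') : finrank K W ≤ finrank K W' :=
  have := h.finiteDimensional_of_le hW'
  finrank_mono hWW'

theorem eq_of_forall_map_le (h : GradedAction T F) {e : ℕ} {W : Submodule K E}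
    (hW : W ≤ F (e + 1)) (hle : ∀ v, (F e).map (T v) ≤ W) : W = F (e + 1) := by
  refine le_antisymm hW ?_
  rw [h.succ]
  exact map₂_le.2 fun v _ x hx => hle v (mem_map_of_mem hx)

/-- Green's restriction theorem. -/
theorem green [Fintype ι] [Infinite K] (h : GradedAction T F) (e : ℕ) (W : Submodule K E)
    (hW : W ≤ F (e + 1)) :
    Generic fun v => finrank K (F (e + 1)) ≤ finrank K (W ⊔ (F e).map (T v) : Submodule K E) +
      macaulayLower (e + 1) (finrank K (F (e + 1)) - finrank K W) := by
  have hsup {e : ℕ} {W : Submodule K E} (hW : W ≤ F (e + 1)) (v) :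
      W ⊔ (F e).map (T v) ≤ F (e + 1) := sup_le hW (h.map_le e v)
  have hlt {e : ℕ} {W : Submodule K E} (hW : W ≤ F (e + 1)) {v}
      (hv : ¬ (F e).map (T v) ≤ W) : finrank K W < finrank K (W ⊔ (F e).map (T v) : Submodule K E) :=
    have := h.finiteDimensional_of_le (hsup hW v)
    finrank_lt_finrank_of_lt (left_lt_sup.2 hv)
  have := fun e => h.finite e
  induction e generalizing W with
  | zero =>
    by_cases hall : ∀ v, (F 0).map (T v) ≤ W
    · refine Generic.of_forall fun v => ?_
      have := h.eq_of_forall_map_le hW hall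
      rw [sup_of_le_left (hall v), ← this]
      omega
    · push Not at hall
      obtain ⟨v₀, hv₀⟩ := hall
      have := h.finiteDimensional_of_le hW
      refine (generic_finrank_le T W (F 0) v₀).mono fun v hv => ?_
      have := hlt hW hv₀
      have := h.finrank_mono_of_le le_rfl hW
      rw [zero_add, macaulayLower_one]
      rw [zero_add] at this
      omega
  | succ e ih =>
    induction hc : finrank K (F (e + 1 + 1)) - finrank K W using Nat.strong_induction_on
      generalizing W with
    | _ c ihc =>
    by_cases hall : ∀ v, (F (e + 1)).map (T v) ≤ W
    · refine Generic.of_forall fun v => ?_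
      have := h.eq_of_forall_map_le hW hall
      rw [sup_of_le_left (hall v), ← this]
      omega
    push Not at hall
    obtain ⟨v₀, hv₀⟩ := hall
    have := h.finiteDimensional_of_le hW
    obtain ⟨u, hu⟩ : ∃ u, ∀ v, finrank K (W ⊔ (F (e + 1)).map (T v) : Submodule K E) ≤
        finrank K (W ⊔ (F (e + 1)).map (T u) : Submodule K E) := by
      have hbdd : BddAbove (Set.range fun v =>
          finrank K (W ⊔ (F (e + 1)).map (T v) : Submodule K E)) :=
        ⟨_, Set.forall_mem_range.2 fun v => h.finrank_mono_of_le le_rfl (hsup hW v)⟩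
      obtain ⟨u, hu⟩ := Nat.sSup_mem (Set.range_nonempty _) hbdd
      refine ⟨u, fun v => ?_⟩
      dsimp only at hu
      rw [hu]
      exact le_csSup hbdd ⟨v, rfl⟩
    have hWu := (hlt hW hv₀).trans_le (hu v₀)
    have hsupu := h.finrank_mono_of_le le_rfl (hsup hW u)
    have hdim := finrank_sup_map_add_finrank_inf_comap (T u) W (F (e + 1))
    have hkey (v) (hv₁ : finrank K (F (e + 1 + 1)) ≤
        finrank K (W ⊔ (F (e + 1)).map (T u) ⊔ (F (e + 1)).map (T v) : Submodule K E) +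
          macaulayLower (e + 1 + 1) (finrank K (F (e + 1 + 1)) -
            finrank K (W ⊔ (F (e + 1)).map (T u) : Submodule K E)))
        (hv₂ : finrank K (F (e + 1)) ≤
          finrank K (F (e + 1) ⊓ W.comap (T u) ⊔ (F e).map (T v) : Submodule K E) +
            macaulayLower (e + 1) (finrank K (F (e + 1)) -
              finrank K (F (e + 1) ⊓ W.comap (T u) : Submodule K E))) :
        finrank K (F (e + 1 + 1)) - finrank K (W ⊔ (F (e + 1)).map (T v) : Submodule K E) ≤
          macaulayLower (e + 1 + 1) (finrank K (F (e + 1 + 1)) -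
            finrank K (W ⊔ (F (e + 1)).map (T u) : Submodule K E)) +
          macaulayLower (e + 1) (c - (finrank K (F (e + 1 + 1)) -
            finrank K (W ⊔ (F (e + 1)).map (T u) : Submodule K E))) := by
      have := h.finiteDimensional_of_le (hsup hW v)
      have hdim' := finrank_sup_map_add_finrank_inf_comap (T u) (W ⊔ (F (e + 1)).map (T v))
        (F (e + 1))
      have hle : F (e + 1) ⊓ W.comap (T u) ⊔ (F e).map (T v) ≤
          F (e + 1) ⊓ (W ⊔ (F (e + 1)).map (T v)).comap (T u) := by
        refine sup_le (inf_le_inf_left _ (comap_mono le_sup_left)) (le_inf (h.map_le e v) ?_)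
        rintro _ ⟨x, hx, rfl⟩
        rw [mem_comap, h.comm]
        exact mem_sup_right (mem_map_of_mem (h.map_le e u (mem_map_of_mem hx)))
      have := h.finrank_mono_of_le inf_le_left hle
      rw [sup_right_comm] at hv₁
      rw [show finrank K (F (e + 1)) - finrank K (F (e + 1) ⊓ W.comap (T u) : Submodule K E) =
        c - (finrank K (F (e + 1 + 1)) -
            finrank K (W ⊔ (F (e + 1)).map (T u) : Submodule K E)) by omega] at hv₂
      omega
    have hgen := (ihc _ (by omega) _ (hsup hW u) rfl).and
      (ih (F (e + 1) ⊓ W.comap (T u)) inf_le_left)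
    obtain ⟨v₁, hv₁⟩ := hgen.exists_of_infinite
    have hcu : finrank K (F (e + 1 + 1)) -
        finrank K (W ⊔ (F (e + 1)).map (T u) : Submodule K E) ≤ macaulayLower (e + 1 + 1) c := by
      refine le_macaulayLower (by omega) (le_trans ?_ (hkey v₁ hv₁.1 hv₁.2))
      exact Nat.sub_le_sub_left (hu v₁) _
    refine (generic_finrank_le T W (F (e + 1)) u).mono fun v hv => ?_
    omega

/-- Macaulay's bound on the growth of a quotient. -/
theorem macaulay [Fintype ι] [Infinite K] (h : GradedAction T F) (e : ℕ) {W W₂ : Submodule K E}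
    (hW : W ≤ F (e + 1)) (hW₂ : W₂ ≤ F (e + 1 + 1)) (hWW₂ : map₂ T ⊤ W ≤ W₂) :
    finrank K (F (e + 1 + 1)) - finrank K W₂ ≤
      macaulayTransform (e + 1) (finrank K (F (e + 1)) - finrank K W) := by
  obtain ⟨v, hv⟩ := (h.green (e + 1) W₂ hW₂).exists_of_infinite
  have := h.finiteDimensional_of_le hW₂
  have := h.finite (e + 1)
  have hdim := finrank_sup_map_add_finrank_inf_comap (T v) W₂ (F (e + 1))
  have hle : W ≤ F (e + 1) ⊓ W₂.comap (T v) :=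
    le_inf hW fun x hx => hWW₂ (apply_mem_map₂ _ mem_top hx)
  have := h.finrank_mono_of_le inf_le_left hle
  have := h.finrank_mono_of_le le_rfl hW
  exact le_macaulayTransform (by omega) (by omega)

theorem restrict_of_maximal_growth [Fintype ι] [Infinite K] (h : GradedAction T F) (e : ℕ)
    {W W₂ : Submodule K E} (hW : W ≤ F (e + 1)) (hW₂ : W₂ ≤ F (e + 1 + 1))
    (hWW₂ : map₂ T ⊤ W ≤ W₂)
    (hgrow : finrank K (F (e + 1 + 1)) - finrank K W₂ =
      macaulayTransform (e + 1) (finrank K (F (e + 1)) - finrank K W))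
    {u : ι → K} (hu : finrank K (F (e + 1)) ≤ finrank K (W ⊔ (F e).map (T u) : Submodule K E) +
      macaulayLower (e + 1) (finrank K (F (e + 1)) - finrank K W)) :
    F (e + 1) ⊓ W₂.comap (T u) = W ∧
      finrank K (F (e + 1 + 1)) - finrank K (W₂ ⊔ (F (e + 1)).map (T u) : Submodule K E) =
        macaulayTransform (e + 1) (finrank K (F (e + 1)) -
          finrank K (W ⊔ (F e).map (T u) : Submodule K E)) ∧
      finrank K (F (e + 1 + 1)) - finrank K (W₂ ⊔ (F (e + 1)).map (T u) : Submodule K E) =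
        macaulayTransform (e + 1)
          (macaulayLower (e + 1) (finrank K (F (e + 1)) - finrank K W)) := by
  have := h.finiteDimensional_of_le hW₂
  have := h.finite (e + 1)
  have hdim := finrank_sup_map_add_finrank_inf_comap (T u) W₂ (F (e + 1))
  have hle : W ≤ F (e + 1) ⊓ W₂.comap (T u) :=
    le_inf hW fun x hx => hWW₂ (apply_mem_map₂ _ mem_top hx)
  have h₁ := h.finrank_mono_of_le inf_le_left hle
  have h₂ := h.finrank_mono_of_le le_rfl hW
  have hsup := sup_le hW (h.map_le e u)
  have hsup₂ := sup_le hW₂ (h.map_le (e + 1) u)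
  have h₃ := h.finrank_mono_of_le le_rfl hsup₂
  have h₄ := h.finrank_mono_of_le hsup₂ le_sup_left
  have hmac := h.macaulay e hsup hsup₂ (by
    rw [map₂_sup_right]
    refine sup_le_sup hWW₂ (map₂_le.2 fun v _ => ?_)
    rintro _ ⟨x, hx, rfl⟩
    rw [h.comm]
    exact mem_map_of_mem (h.map_le e v (mem_map_of_mem hx)))
  have hmono := macaulayTransform_mono (e + 1) (Nat.sub_le_iff_le_add'.2 hu)
  have hadd := macaulayTransform_eq_add (by omega : 1 ≤ e + 1) (finrank K (F (e + 1)) - finrank K W)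
  have h₅ := h.finrank_mono_of_le le_rfl (inf_le_left : F (e + 1) ⊓ W₂.comap (T u) ≤ _)
  refine ⟨?_, by omega, by omega⟩
  have := h.finiteDimensional_of_le (inf_le_left : F (e + 1) ⊓ W₂.comap (T u) ≤ _)
  exact (eq_of_le_of_finrank_le hle (by omega)).symm

theorem persistence_aux [Fintype ι] [Infinite K] (h : GradedAction T F) (e : ℕ)
    {N : Submodule K E} (hN : N ≤ F (e + 1))
    (hreg : ∀ (L : Submodule K (ι → K)) (u : ι → K), u ∉ L → ∀ x ∈ F (e + 1 + 1),
      T u x ∈ map₂ T L (F (e + 1 + 1)) → x ∈ map₂ T L (F (e + 1)))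
    (L : Submodule K (ι → K))
    (hL : map₂ T ⊤ N ⊓ map₂ T L (F (e + 1)) ≤ map₂ T L N)
    (hgrow : finrank K (F (e + 1 + 1)) -
        finrank K (map₂ T ⊤ N ⊔ map₂ T L (F (e + 1)) : Submodule K E) =
      macaulayTransform (e + 1) (finrank K (F (e + 1)) -
        finrank K (N ⊔ map₂ T L (F e) : Submodule K E))) :
    map₂ T ⊤ (map₂ T ⊤ N) ⊓ map₂ T L (F (e + 1 + 1)) ≤ map₂ T L (map₂ T ⊤ N) ∧
    finrank K (F (e + 1 + 1 + 1)) -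
        finrank K (map₂ T ⊤ (map₂ T ⊤ N) ⊔ map₂ T L (F (e + 1 + 1)) : Submodule K E) =
      macaulayTransform (e + 1 + 1) (finrank K (F (e + 1 + 1)) -
        finrank K (map₂ T ⊤ N ⊔ map₂ T L (F (e + 1)) : Submodule K E)) := by
  set N₂ := map₂ T ⊤ N with hN₂
  set N₃ := map₂ T ⊤ N₂ with hN₃
  have hN₂F : N₂ ≤ F (e + 1 + 1) := (map₂_le_map₂_right hN).trans (h.map₂_le_succ _ _)
  have hN₃F : N₃ ≤ F (e + 1 + 1 + 1) := (map₂_le_map₂_right hN₂F).trans (h.map₂_le_succ _ _)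
  have huN (u) {x} (hx : x ∈ N) : T u x ∈ N₂ := apply_mem_map₂ _ mem_top hx
  have huN₂ (u) {x} (hx : x ∈ N₂) : T u x ∈ N₃ := apply_mem_map₂ _ mem_top hx
  induction L using WellFoundedGT.induction with
  | _ L ih =>
  by_cases hLtop : L = ⊤
  · subst hLtop
    refine ⟨inf_le_left, ?_⟩
    rw [← h.succ, ← h.succ, sup_eq_right.2 hN₂F, sup_eq_right.2 hN₃F, Nat.sub_self, Nat.sub_self,
      macaulayTransform_zero]
  have hW₁ : N ⊔ map₂ T L (F e) ≤ F (e + 1) := sup_le hN (h.map₂_le_succ _ _)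
  have hW₂ : N₂ ⊔ map₂ T L (F (e + 1)) ≤ F (e + 1 + 1) := sup_le hN₂F (h.map₂_le_succ _ _)
  have hW₃ : N₃ ⊔ map₂ T L (F (e + 1 + 1)) ≤ F (e + 1 + 1 + 1) :=
    sup_le hN₃F (h.map₂_le_succ _ _)
  have hW₁₂ : map₂ T ⊤ (N ⊔ map₂ T L (F e)) ≤ N₂ ⊔ map₂ T L (F (e + 1)) := by
    rw [map₂_sup_right]
    refine sup_le_sup le_rfl ((h.map₂_map₂_le _ _ _).trans ?_)
    rw [← h.succ]
  obtain ⟨u, huL, hu⟩ := ((Generic.notMem hLtop).and (h.green e _ hW₁)).exists_of_infinite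
  obtain ⟨hinj, hgrow', hlow⟩ := h.restrict_of_maximal_growth e hW₁ hW₂ hW₁₂ hgrow hu
  have hL' (A : Submodule K E) : map₂ T (L ⊔ K ∙ u) A = map₂ T L A ⊔ A.map (T u) := by
    rw [map₂_sup_left, map₂_span_singleton_eq_map]
  have hLlt : L < L ⊔ K ∙ u := left_lt_sup.2 (by simpa using huL)
  obtain ⟨ih₁, ih₂⟩ := ih _ hLlt (by
    rintro x ⟨hxN, hx⟩
    rw [SetLike.mem_coe, hL'] at hx
    obtain ⟨q, hq, _, ⟨y, hy, rfl⟩, rfl⟩ := mem_sup.1 hx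
    have hy' : y ∈ N ⊔ map₂ T L (F e) := by
      rw [← hinj]
      refine ⟨hy, ?_⟩
      rw [SetLike.mem_coe, mem_comap, ← add_sub_cancel_left q (T u y)]
      exact sub_mem (mem_sup_left hxN) (mem_sup_right hq)
    obtain ⟨m, hm, g, hg, rfl⟩ := mem_sup.1 hy'
    have hug : T u g ∈ map₂ T L (F (e + 1)) := h.apply_mem_map₂_map (h.map_le e u) hg
    rw [map_add, add_left_comm, ← add_comm (q + _)] at hxN ⊢
    rw [hL']
    refine add_mem_sup (hL ⟨?_, add_mem hq hug⟩) (mem_map_of_mem hm)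
    exact (add_mem_cancel_right (huN u hm)).1 hxN) (by
    rw [hL', hL', ← sup_assoc, ← sup_assoc]
    exact hgrow')
  rw [hL', hL'] at ih₁
  rw [hL', hL', ← sup_assoc, ← sup_assoc] at ih₂
  have hcolon {y} (hy : y ∈ N₂) (huy : T u y ∈ map₂ T L (F (e + 1 + 1))) :
      T u y ∈ map₂ T L N₂ :=
    h.apply_mem_map₂_map (A := N) (B := N₂) (u := u)
      (map_le_iff_le_comap.2 fun x hx => huN u hx)
      (hL ⟨hy, hreg L u huL y (hN₂F hy) huy⟩)
  have hle₂₃ {x} (hx : x ∈ map₂ T L N₂) : x ∈ map₂ T L (F (e + 1 + 1)) :=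
    map₂_le_map₂_right hN₂F hx
  refine ⟨?_, ?_⟩
  · rintro x ⟨hxN, hx⟩
    obtain ⟨q, hq, _, ⟨y, hy, rfl⟩, rfl⟩ := mem_sup.1 (ih₁ ⟨hxN, mem_sup_left hx⟩)
    refine add_mem hq (hcolon hy ?_)
    exact (add_mem_cancel_left (hle₂₃ hq)).1 hx
  · have hinj₂ : F (e + 1 + 1) ⊓ (N₃ ⊔ map₂ T L (F (e + 1 + 1))).comap (T u) =
        N₂ ⊔ map₂ T L (F (e + 1)) := by
      refine le_antisymm ?_ (le_inf hW₂ (sup_le (fun x hx => mem_sup_left (huN₂ u hx))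
        fun x hx => mem_sup_right (h.apply_mem_map₂_map (h.map_le _ u) hx)))
      rintro x ⟨hx, hux⟩
      obtain ⟨ν, hν, q, hq, hνq⟩ := mem_sup.1 hux
      obtain ⟨q', hq', _, ⟨y, hy, rfl⟩, hνy⟩ := mem_sup.1 (ih₁ (x := ν) ⟨hν, by
        rw [eq_sub_of_add_eq hνq]
        exact sub_mem (mem_sup_right (mem_map_of_mem hx)) (mem_sup_left hq)⟩)
      have hxy : x - y ∈ map₂ T L (F (e + 1)) := by
        refine hreg L u huL _ (sub_mem hx (hN₂F hy)) ?_
        rw [map_sub, ← hνq, ← hνy, show q' + T u y + q - T u y = q' + q by abel]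
        exact add_mem (hle₂₃ hq') hq
      rw [← add_sub_cancel y x]
      exact add_mem_sup hy hxy
    have := h.finiteDimensional_of_le hW₃
    have := h.finite (e + 1 + 1)
    have hdim := finrank_sup_map_add_finrank_inf_comap (T u) (N₃ ⊔ map₂ T L (F (e + 1 + 1)))
      (F (e + 1 + 1))
    rw [hinj₂] at hdim
    have h₂ := h.finrank_mono_of_le le_rfl hW₂
    have h₃ := h.finrank_mono_of_le le_rfl (sup_le hW₃ (h.map_le (e + 1 + 1) u))
    rw [hlow, ← macaulayLower_macaulayTransform (by omega), ← hgrow] at ih₂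
    have := macaulayTransform_eq_add (by omega : 1 ≤ e + 1 + 1) (finrank K (F (e + 1 + 1)) -
        finrank K (N₂ ⊔ map₂ T L (F (e + 1)) : Submodule K E))
    have := h.finrank_mono_of_le le_rfl hW₃
    omega

theorem persistence [Fintype ι] [Infinite K] (h : GradedAction T F) (e : ℕ)
    {N : Submodule K E} (hN : N ≤ F (e + 1))
    (hreg : ∀ (L : Submodule K (ι → K)) (u : ι → K), u ∉ L → ∀ x ∈ F (e + 1 + 1),
      T u x ∈ map₂ T L (F (e + 1 + 1)) → x ∈ map₂ T L (F (e + 1)))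
    (hgrow : finrank K (F (e + 1 + 1)) - finrank K (map₂ T ⊤ N) =
      macaulayTransform (e + 1) (finrank K (F (e + 1)) - finrank K N)) :
    finrank K (F (e + 1 + 1 + 1)) - finrank K (map₂ T ⊤ (map₂ T ⊤ N)) =
      macaulayTransform (e + 1 + 1) (finrank K (F (e + 1 + 1)) - finrank K (map₂ T ⊤ N)) := by
  have := h.persistence_aux e hN hreg ⊥
  rw [map₂_bot_left, map₂_bot_left, map₂_bot_left, map₂_bot_left, sup_bot_eq, sup_bot_eq,
    sup_bot_eq] at this
  exact (this inf_le_right hgrow).2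

end GradedAction

end LinearAlgebra

section Polynomial

open Module Submodule MvPolynomial

variable (K : Type*) [Field K] {σ : Type*} {r : ℕ}

/-- The elements of a free module of rank `r` whose `i`-th coordinate is homogeneous of degree
`e + s i`. -/
noncomputable def shiftPiece (σ : Type*) (s : Fin r → ℕ) (e : ℕ) :
    Submodule K (Fin r → MvPolynomial σ K) :=
  Submodule.pi Set.univ fun i => homogeneousSubmodule σ K (e + s i)

variable {K}

theorem mem_shiftPiece {s : Fin r → ℕ} {e : ℕ} {x : Fin r → MvPolynomial σ K} :
    x ∈ shiftPiece K σ s e ↔ ∀ i, (x i).IsHomogeneous (e + s i) := by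
  simp [shiftPiece, Submodule.mem_pi]

variable (K) [Fintype σ]

/-- The linear form with given coefficients. -/
noncomputable def linearForm : (σ → K) →ₗ[K] MvPolynomial σ K :=
  Fintype.linearCombination K (X : σ → MvPolynomial σ K)

/-- Multiplication by linear forms on a free module. -/
noncomputable def mulLinearForm (r : ℕ) :
    (σ → K) →ₗ[K] End K (Fin r → MvPolynomial σ K) :=
  (Algebra.lsmul K K (Fin r → MvPolynomial σ K)).toLinearMap ∘ₗ linearForm K

variable {K}

theorem mulLinearForm_apply (v : σ → K) (x : Fin r → MvPolynomial σ K) :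
    mulLinearForm K r v x = linearForm K v • x := rfl

theorem linearForm_single [DecidableEq σ] (i : σ) :
    linearForm K (Pi.single i 1) = (X i : MvPolynomial σ K) := by
  simp [linearForm, Fintype.linearCombination_apply, Pi.single_apply]

theorem range_linearForm :
    LinearMap.range (linearForm K : (σ → K) →ₗ[K] MvPolynomial σ K) =
      homogeneousSubmodule σ K 1 := by
  rw [linearForm, Fintype.range_linearCombination, homogeneousSubmodule_one_eq_span_X]

theorem isHomogeneous_linearForm (v : σ → K) : (linearForm K v).IsHomogeneous 1 := by
  rw [← mem_homogeneousSubmodule, ← range_linearForm]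
  exact LinearMap.mem_range_self _ v

theorem linearForm_eq_zero {v : σ → K} (h : linearForm K v = 0) : v = 0 := by
  classical
  ext i
  simpa [linearForm, Fintype.linearCombination_apply, coeff_sum, coeff_X,
    Finsupp.single_left_inj] using congrArg (coeff (Finsupp.single i 1)) h

/-- Multiplication of a polynomial by a linear form. -/
noncomputable abbrev linearFormMul : (σ → K) →ₗ[K] End K (MvPolynomial σ K) :=
  LinearMap.mul K (MvPolynomial σ K) ∘ₗ linearForm K

theorem mem_map₂_linearFormMul {m : ℕ} {p : MvPolynomial σ K} (hp : p.IsHomogeneous (m + 1)) :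
    p ∈ map₂ linearFormMul ⊤ (homogeneousSubmodule σ K m) := by
  have h : p ∈ homogeneousSubmodule σ K 1 * homogeneousSubmodule σ K m := by
    rw [← homogeneousSubmodule_one_pow (σ := σ) (R := K) m, ← pow_succ', homogeneousSubmodule_one_pow]
    exact hp
  rw [← range_linearForm] at h
  refine Submodule.mul_induction_on h ?_ fun _ _ => add_mem
  rintro _ ⟨v, rfl⟩ q hq
  exact apply_mem_map₂ (linearFormMul : (σ → K) →ₗ[K] End K (MvPolynomial σ K)) mem_top hq

theorem mem_map₂_mulLinearForm {s : Fin r → ℕ} {e : ℕ} {L : Submodule K (σ → K)}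
    {x : Fin r → MvPolynomial σ K}
    (hx : ∀ i, x i ∈ map₂ linearFormMul L (homogeneousSubmodule σ K (e + s i))) :
    x ∈ map₂ (mulLinearForm K r) L (shiftPiece K σ s e) := by
  classical
  rw [← Finset.univ_sum_single x]
  refine sum_mem fun i _ => ?_
  suffices map₂ linearFormMul L (homogeneousSubmodule σ K (e + s i)) ≤
      (map₂ (mulLinearForm K r) L (shiftPiece K σ s e)).comap (LinearMap.single K _ i) from
    this (hx i)
  refine map₂_le.2 fun v hv q hq => ?_
  have : mulLinearForm K r v (Pi.single i q) ∈ map₂ (mulLinearForm K r) L (shiftPiece K σ s e) := by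
    refine apply_mem_map₂ _ hv (mem_shiftPiece.2 fun j => ?_)
    obtain rfl | hj := eq_or_ne j i
    · rwa [Pi.single_eq_same]
    · rw [Pi.single_eq_of_ne hj]
      exact isHomogeneous_zero _ _ _
  rw [mulLinearForm_apply, ← Pi.single_smul'] at this
  exact this

theorem gradedAction_mulLinearForm (s : Fin r → ℕ) :
    GradedAction (mulLinearForm K r) (shiftPiece K σ s) where
  comm u v x := smul_comm (linearForm K u) (linearForm K v) x
  finite e := by
    have (i : Fin r) : FiniteDimensional K (homogeneousSubmodule σ K (e + s i)) :=
      Module.Finite.iff_fg.2 (homogeneousSubmodule_fg σ K _)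
    let g : shiftPiece K σ s e →ₗ[K] ∀ i, homogeneousSubmodule σ K (e + s i) :=
      LinearMap.pi fun i => (LinearMap.proj i ∘ₗ Submodule.subtype _).codRestrict _
        fun x => mem_shiftPiece.1 x.2 i
    refine Module.Finite.of_injective g fun x y hxy => ?_
    ext1
    funext i
    exact congrArg Subtype.val (congrFun hxy i)
  succ e := by
    refine le_antisymm (fun x hx => mem_map₂_mulLinearForm fun i => ?_)
      (map₂_le.2 fun v _ x hx => mem_shiftPiece.2 fun i => ?_)
    · refine mem_map₂_linearFormMul ?_
      rw [add_right_comm]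
      exact mem_shiftPiece.1 hx i
    · rw [mulLinearForm_apply, Pi.smul_apply, smul_eq_mul, add_assoc, add_left_comm]
      exact (isHomogeneous_linearForm v).mul (mem_shiftPiece.1 hx i)

/-- The algebra endomorphism induced by a linear endomorphism of the linear forms. -/
noncomputable def substLinear (g : (σ → K) →ₗ[K] (σ → K)) :
    MvPolynomial σ K →ₐ[K] MvPolynomial σ K :=
  letI := Classical.decEq σ
  aeval fun i => linearForm K (g (Pi.single i 1))

theorem substLinear_linearForm (g : (σ → K) →ₗ[K] (σ → K)) (v : σ → K) :
    substLinear g (linearForm K v) = linearForm K (g v) := by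
  classical
  suffices (substLinear g).toLinearMap ∘ₗ linearForm K = linearForm K ∘ₗ g from
    LinearMap.congr_fun this v
  refine LinearMap.pi_ext' fun i => LinearMap.ext_ring ?_
  simp [linearForm_single, substLinear]

theorem isHomogeneous_substLinear (g : (σ → K) →ₗ[K] (σ → K)) {m : ℕ} {p : MvPolynomial σ K}
    (hp : p.IsHomogeneous m) : (substLinear g p).IsHomogeneous m := by
  classical
  simpa [substLinear] using hp.aeval (fun i => linearForm K (g (Pi.single i 1)))
    fun i => isHomogeneous_linearForm _

theorem substLinear_sub_mem {g : (σ → K) →ₗ[K] (σ → K)} {L : Submodule K (σ → K)}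
    (hg : ∀ v, v - g v ∈ L) {m : ℕ} {p : MvPolynomial σ K} (hp : p.IsHomogeneous (m + 1)) :
    p - substLinear g p ∈ map₂ linearFormMul L (homogeneousSubmodule σ K m) := by
  suffices map₂ linearFormMul ⊤ (homogeneousSubmodule σ K m) ≤
      (map₂ linearFormMul L (homogeneousSubmodule σ K m)).comap
        (LinearMap.id - (substLinear g).toLinearMap) from this (mem_map₂_linearFormMul hp)
  induction m generalizing p with
  | zero =>
    refine map₂_le.2 fun v _ q hq => ?_
    obtain ⟨c, rfl⟩ : ∃ c, q = C c := ⟨_, totalDegree_eq_zero_iff_eq_C.1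
      ((totalDegree_zero_iff_isHomogeneous σ).2 hq)⟩
    have := apply_mem_map₂ (linearFormMul : (σ → K) →ₗ[K] End K (MvPolynomial σ K)) (hg v) hq
    simpa [substLinear_linearForm, sub_mul, ← algebraMap_eq] using this
  | succ m ih =>
    refine map₂_le.2 fun v _ q hq => ?_
    have h₁ := apply_mem_map₂ (linearFormMul : (σ → K) →ₗ[K] End K (MvPolynomial σ K)) (hg v)
      ((mem_homogeneousSubmodule _ _).2 (isHomogeneous_substLinear g hq))
    have h₂ : linearForm K v * (q - substLinear g q) ∈
        map₂ linearFormMul L (homogeneousSubmodule σ K (m + 1)) := by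
      have hq' := ih hq (mem_map₂_linearFormMul hq)
      suffices map₂ linearFormMul L (homogeneousSubmodule σ K m) ≤
          (map₂ linearFormMul L (homogeneousSubmodule σ K (m + 1))).comap (linearFormMul v) from
        this hq'
      refine map₂_le.2 fun u hu y hy => ?_
      have := apply_mem_map₂ (linearFormMul : (σ → K) →ₗ[K] End K (MvPolynomial σ K)) hu
        (by simpa [add_comm] using (isHomogeneous_linearForm v).mul hy :
          linearForm K v * y ∈ homogeneousSubmodule σ K (m + 1))
      simpa [mul_left_comm] using this
    have := add_mem h₁ h₂
    simpa [substLinear_linearForm, sub_mul, mul_sub] using this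

theorem mem_map₂_mulLinearForm_of_smul_mem {s : Fin r → ℕ} {e e' : ℕ} {L : Submodule K (σ → K)}
    {u : σ → K} (hu : u ∉ L) {x : Fin r → MvPolynomial σ K} (hx : x ∈ shiftPiece K σ s (e + 1))
    (hux : mulLinearForm K r u x ∈ map₂ (mulLinearForm K r) L (shiftPiece K σ s e')) :
    x ∈ map₂ (mulLinearForm K r) L (shiftPiece K σ s e) := by
  obtain ⟨L', hL'⟩ := L.exists_isCompl
  set g := L'.projection L hL'.symm with hg
  refine mem_map₂_mulLinearForm fun i => ?_
  have hker (v) (hv : v ∈ L) : g v = 0 := (projection_apply_eq_zero_iff hL'.symm).2 hv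
  have hsub (v) : v - g v ∈ L := sub_projection_mem hL'.symm v
  have hzero : substLinear g (x i) = 0 := by
    suffices map₂ (mulLinearForm K r) L (shiftPiece K σ s e') ≤
        LinearMap.ker ((substLinear g).toLinearMap ∘ₗ LinearMap.proj i) by
      have h := this hux
      rw [LinearMap.mem_ker] at h
      have h' : linearForm K (g u) * substLinear g (x i) = 0 := by
        simpa [mulLinearForm_apply, substLinear_linearForm] using h
      refine (mul_eq_zero.1 h').resolve_left fun h₀ => hu ?_
      simpa [linearForm_eq_zero h₀] using hsub u
    refine map₂_le.2 fun v hv y _ => ?_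
    simp [mulLinearForm_apply, substLinear_linearForm, hker v hv]
  have := substLinear_sub_mem hsub (p := x i) (m := e + s i) (by
    rw [add_right_comm]
    exact mem_shiftPiece.1 hx i)
  rwa [hzero, sub_zero] at this

end Polynomial

section Graded

open Module Submodule MvPolynomial

variable {K : Type} [Field K] {n r : ℕ} {f : Fin r → ℤ}

theorem mem_freeDegPiece {m : ℤ} {x : Fin r → MvPolynomial (Fin (n + 1)) K} :
    x ∈ freeDegPiece K n r f m ↔ ∀ i, x i ∈ degPiece K n (m - f i) := by
  simp [freeDegPiece, Submodule.mem_pi]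

theorem degPiece_of_nonneg {e : ℤ} (he : 0 ≤ e) :
    degPiece K n e = homogeneousSubmodule (Fin (n + 1)) K e.toNat := if_pos he

theorem degPiece_of_neg {e : ℤ} (he : e < 0) : degPiece K n e = ⊥ := if_neg (not_le.2 he)

theorem freeDegPiece_eq_shiftPiece {l : ℤ} (hf : ∀ i, f i ≤ l) {e : ℕ} {m : ℤ} (hm : m = e + l) :
    freeDegPiece K n r f m =
      shiftPiece K (Fin (n + 1)) (fun i => (l - f i).toNat) e := by
  ext x
  rw [mem_freeDegPiece, mem_shiftPiece]
  refine forall_congr' fun i => ?_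
  have := hf i
  rw [degPiece_of_nonneg (by omega), mem_homogeneousSubmodule,
    show (m - f i).toNat = e + (l - f i).toNat by omega]

theorem monomial_smul_mem_freeDegPiece {k : ℤ} {x : Fin r → MvPolynomial (Fin (n + 1)) K}
    (hx : x ∈ freeDegPiece K n r f k) (α : Fin (n + 1) →₀ ℕ) (c : K) :
    monomial α c • x ∈ freeDegPiece K n r f (k + α.degree) := by
  rw [mem_freeDegPiece] at hx ⊢
  intro i
  have hxi := hx i
  rw [Pi.smul_apply, smul_eq_mul]
  rcases lt_or_ge (k - f i) 0 with h | h
  · rw [degPiece_of_neg h, mem_bot] at hxi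
    rw [hxi, mul_zero]
    exact zero_mem _
  · rw [degPiece_of_nonneg h, mem_homogeneousSubmodule] at hxi
    rw [degPiece_of_nonneg (by omega), mem_homogeneousSubmodule,
      show (k + α.degree - f i).toNat = α.degree + (k - f i).toNat by omega]
    exact (isHomogeneous_monomial c rfl).mul hxi

variable (K n f) in
/-- The projection of a free module onto its graded piece of degree `m`. -/
noncomputable def gradedProj (m : ℤ) : (Fin r → MvPolynomial (Fin (n + 1)) K) →ₗ[K]
    (Fin r → MvPolynomial (Fin (n + 1)) K) :=
  LinearMap.pi fun i =>
    if 0 ≤ m - f i then homogeneousComponent (m - f i).toNat ∘ₗ LinearMap.proj i else 0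

theorem gradedProj_of_mem {k : ℤ} {x : Fin r → MvPolynomial (Fin (n + 1)) K}
    (hx : x ∈ freeDegPiece K n r f k) (m : ℤ) :
    gradedProj K n f m x = if m = k then x else 0 := by
  funext i
  have hxi := mem_freeDegPiece.1 hx i
  rw [gradedProj, LinearMap.pi_apply, apply_ite (fun y : Fin r → MvPolynomial _ K => y i),
    Pi.zero_apply]
  rcases lt_or_ge (k - f i) 0 with h | h
  · rw [degPiece_of_neg h, mem_bot] at hxi
    split_ifs <;> simp [hxi]
  · rw [degPiece_of_nonneg h] at hxi
    rcases lt_or_ge (m - f i) 0 with h' | h'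
    · rw [if_neg (by omega), if_neg (by omega), LinearMap.zero_apply]
    · rw [if_pos h', LinearMap.comp_apply, LinearMap.proj_apply, homogeneousComponent_of_mem hxi]
      congr 1
      exact propext (by omega)

theorem span_restrictScalars_le_of_monomial_smul_mem {σ E : Type*} [AddCommGroup E] [Module K E]
    [Module (MvPolynomial σ K) E] [IsScalarTower K (MvPolynomial σ K) E] {G : Set E}
    {A : Submodule K E} (h : ∀ g ∈ G, ∀ (α : σ →₀ ℕ) (c : K), monomial α c • g ∈ A) :
    (span (MvPolynomial σ K) G).restrictScalars K ≤ A := by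
  let B : Submodule (MvPolynomial σ K) E :=
    { carrier := {x | ∀ p : MvPolynomial σ K, p • x ∈ A}
      add_mem' := fun hx hy p => by
        rw [smul_add]
        exact add_mem (hx p) (hy p)
      zero_mem' := fun p => by
        rw [smul_zero]
        exact zero_mem _
      smul_mem' := fun q x hx p => by
        rw [smul_smul]
        exact hx _ }
  have hB : span (MvPolynomial σ K) G ≤ B := span_le.2 fun g hg p => by
    induction p using MvPolynomial.induction_on' with
    | monomial α c => exact h g hg α c
    | add p q hp hq =>
      rw [add_smul]
      exact add_mem hp hq
  intro x hx
  simpa using hB hx 1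

theorem inf_freeDegPiece_succ {l d m : ℤ} (hf : ∀ i, f i ≤ l)
    {G : Set (Fin r → MvPolynomial (Fin (n + 1)) K)}
    (hG : ∀ g ∈ G, ∃ k ≤ d, g ∈ freeDegPiece K n r f k) (hdm : d ≤ m) (hlm : l ≤ m) :
    (span (MvPolynomial (Fin (n + 1)) K) G).restrictScalars K ⊓ freeDegPiece K n r f (m + 1) =
      map₂ (mulLinearForm K r) ⊤
        ((span (MvPolynomial (Fin (n + 1)) K) G).restrictScalars K ⊓
          freeDegPiece K n r f m) := by
  obtain ⟨e, he⟩ := Int.eq_ofNat_of_zero_le (by omega : 0 ≤ m - l)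
  refine le_antisymm ?_ (le_inf (map₂_le.2 fun v _ x hx =>
    (span (MvPolynomial (Fin (n + 1)) K) G).smul_mem (linearForm K v) hx.1) ?_)
  · rintro x ⟨hxN, hx⟩
    have hproj := gradedProj_of_mem hx (m + 1)
    rw [if_pos rfl] at hproj
    rw [← hproj]
    refine span_restrictScalars_le_of_monomial_smul_mem (G := G)
      (A := (map₂ (mulLinearForm K r) ⊤
        ((span (MvPolynomial (Fin (n + 1)) K) G).restrictScalars K ⊓
          freeDegPiece K n r f m)).comap (gradedProj K n f (m + 1))) (fun g hg α c => ?_) hxN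
    obtain ⟨k, hkd, hk⟩ := hG g hg
    rw [mem_comap, gradedProj_of_mem (monomial_smul_mem_freeDegPiece hk α c)]
    split_ifs with hkm
    · obtain ⟨i, hi⟩ : ∃ i, α i ≠ 0 := by
        by_contra! hα
        have : α = 0 := Finsupp.ext hα
        simp only [this, map_zero] at hkm
        omega
      have hα : α = Finsupp.single i 1 + (α - Finsupp.single i 1) :=
        (add_tsub_cancel_of_le (Finsupp.single_le_iff.2 (Nat.one_le_iff_ne_zero.2 hi))).symm
      have hdeg : α.degree = 1 + (α - Finsupp.single i 1).degree :=
        (congrArg Finsupp.degree hα).trans (by rw [map_add, Finsupp.degree_single])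
      have hmon : monomial α c = linearForm K (Pi.single i 1) *
          monomial (α - Finsupp.single i 1) c := by
        rw [linearForm_single, X, monomial_mul, one_mul, ← hα]
      rw [hmon, mul_smul]
      refine apply_mem_map₂ (mulLinearForm K r) mem_top
        ⟨smul_mem _ _ (subset_span hg), ?_⟩
      have hm : m = k + ((α - Finsupp.single i 1).degree : ℕ) := by
        rw [hdeg] at hkm
        push_cast at hkm
        omega
      rw [hm]
      exact monomial_smul_mem_freeDegPiece hk (α - Finsupp.single i 1) c
    · exact zero_mem _
  · rw [freeDegPiece_eq_shiftPiece hf (e := e) (by omega : m = e + l),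
      freeDegPiece_eq_shiftPiece hf (e := e + 1) (by push_cast; omega)]
    exact (map₂_le_map₂_right inf_le_right).trans
      ((gradedAction_mulLinearForm _).map₂_le_succ _ _)

theorem hilbFn_persistence_of_infinite [Infinite K] {l d : ℤ} (hf : ∀ i, f i ≤ l) (hd : l + 1 ≤ d)
    {G : Set (Fin r → MvPolynomial (Fin (n + 1)) K)}
    (hG : ∀ g ∈ G, ∃ k ≤ d, g ∈ freeDegPiece K n r f k)
    (hpers : hilbFn K n r f (span (MvPolynomial (Fin (n + 1)) K) G) (d + 1) =
      macaulayTransform (d - l).toNat (hilbFn K n r f (span (MvPolynomial (Fin (n + 1)) K) G) d)) :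
    hilbFn K n r f (span (MvPolynomial (Fin (n + 1)) K) G) (d + 2) =
      macaulayTransform (d + 1 - l).toNat
        (hilbFn K n r f (span (MvPolynomial (Fin (n + 1)) K) G) (d + 1)) := by
  obtain ⟨e, he⟩ := Int.eq_ofNat_of_zero_le (by omega : 0 ≤ d - l - 1)
  have h := gradedAction_mulLinearForm (K := K) (σ := Fin (n + 1)) fun i => (l - f i).toNat
  have h₁ := freeDegPiece_eq_shiftPiece (K := K) (n := n) hf (e := e + 1) (m := d)
    (by push_cast; omega)
  have h₂ := freeDegPiece_eq_shiftPiece (K := K) (n := n) hf (e := e + 1 + 1) (m := d + 1)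
    (by push_cast; omega)
  have h₃ := freeDegPiece_eq_shiftPiece (K := K) (n := n) hf (e := e + 1 + 1 + 1) (m := d + 1 + 1)
    (by push_cast; omega)
  rw [show d + 2 = d + 1 + 1 by ring]
  simp only [hilbFn] at hpers ⊢
  rw [inf_freeDegPiece_succ hf hG le_rfl (by omega), h₁, h₂, show (d - l).toNat = e + 1 by omega]
    at hpers
  rw [inf_freeDegPiece_succ hf hG (by omega) (by omega),
    inf_freeDegPiece_succ hf hG le_rfl (by omega), h₁, h₂, h₃,
    show (d + 1 - l).toNat = e + 1 + 1 by omega]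
  exact h.persistence e inf_le_right
    (fun L u hu x hx hux => mem_map₂_mulLinearForm_of_smul_mem hu hx hux) hpers

end Graded

section BaseChange

open Module Submodule MvPolynomial

section

variable {K : Type*} (K' : Type*) [Field K] [Field K'] [Algebra K K'] {σ : Type*} {r : ℕ}

/-- Coordinatewise extension of scalars on a free module over a polynomial ring. -/
noncomputable def extendCoeff :
    (Fin r → MvPolynomial σ K) →ₗ[K] (Fin r → MvPolynomial σ K') :=
  (MvPolynomial.mapAlgHom (Algebra.ofId K K')).toLinearMap.compLeft (Fin r)

theorem extendCoeff_apply (x : Fin r → MvPolynomial σ K) (i : Fin r) :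
    extendCoeff K' x i = MvPolynomial.map (algebraMap K K') (x i) := rfl

theorem extendCoeff_smul (p : MvPolynomial σ K) (x : Fin r → MvPolynomial σ K) :
    extendCoeff K' (p • x) = MvPolynomial.map (algebraMap K K') p • extendCoeff K' x := by
  funext i
  simp [extendCoeff_apply]

theorem linearIndependent_extendCoeff {ι : Type*} [Fintype ι] {b : ι → Fin r → MvPolynomial σ K}
    (hb : LinearIndependent K b) : LinearIndependent K' fun i => extendCoeff K' (b i) := by
  rw [Fintype.linearIndependent_iff] at hb ⊢
  intro c hc i
  refine (Module.forall_dual_apply_eq_zero_iff K (c i)).1 fun φ => hb (fun i => φ (c i)) ?_ i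
  funext j
  ext α
  have h := congrArg (fun y : Fin r → MvPolynomial σ K' => φ (coeff α (y j))) hc
  have hφ (x : K') (a : K) : φ (x * algebraMap K K' a) = φ x * a := by
    rw [mul_comm, ← Algebra.smul_def, map_smul, smul_eq_mul, mul_comm]
  simpa [coeff_sum, extendCoeff_apply, coeff_map, hφ] using h

theorem finrank_span_extendCoeff (A : Submodule K (Fin r → MvPolynomial σ K))
    [FiniteDimensional K A] :
    finrank K' (span K' (extendCoeff K' '' (A : Set (Fin r → MvPolynomial σ K)))) = finrank K A := by
  have hb : LinearIndependent K fun i => (finBasis K A i : Fin r → MvPolynomial σ K) :=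
    (finBasis K A).linearIndependent.map' A.subtype A.ker_subtype
  have hspan : span K' (extendCoeff K' '' (A : Set (Fin r → MvPolynomial σ K))) =
      span K' (Set.range fun i => extendCoeff K' (finBasis K A i : Fin r → MvPolynomial σ K)) := by
    refine le_antisymm (span_le.2 ?_) (span_mono ?_)
    · rintro _ ⟨x, hx, rfl⟩
      have h := congrArg (fun y : A => extendCoeff K' (y : Fin r → MvPolynomial σ K))
        ((finBasis K A).sum_repr ⟨x, hx⟩)
      simp only [AddSubmonoidClass.coe_finsetSum, map_sum, SetLike.val_smul, map_smul] at h
      rw [← h]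
      refine sum_mem fun i _ => ?_
      rw [← algebraMap_smul K']
      exact smul_mem _ _ (subset_span ⟨i, rfl⟩)
    · rintro _ ⟨i, rfl⟩
      exact ⟨_, (finBasis K A i).2, rfl⟩
  rw [hspan, finrank_span_eq_card (linearIndependent_extendCoeff K' hb), Fintype.card_fin]

end

variable {K : Type} (K' : Type) [Field K] [Field K'] [Algebra K K'] {n r : ℕ} {f : Fin r → ℤ}

theorem extendCoeff_mem_freeDegPiece {m : ℤ} {x : Fin r → MvPolynomial (Fin (n + 1)) K}
    (hx : x ∈ freeDegPiece K n r f m) : extendCoeff K' x ∈ freeDegPiece K' n r f m := by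
  rw [mem_freeDegPiece] at hx ⊢
  intro i
  have hxi := hx i
  rw [extendCoeff_apply]
  rcases lt_or_ge (m - f i) 0 with h | h
  · rw [degPiece_of_neg h, mem_bot] at hxi
    rw [hxi, map_zero]
    exact zero_mem _
  · rw [degPiece_of_nonneg h, mem_homogeneousSubmodule] at hxi ⊢
    exact hxi.map _

theorem span_extendCoeff_inf_freeDegPiece {G : Set (Fin r → MvPolynomial (Fin (n + 1)) K)}
    (hG : ∀ g ∈ G, ∃ k, g ∈ freeDegPiece K n r f k) (m : ℤ) :
    (span (MvPolynomial (Fin (n + 1)) K') (extendCoeff K' '' G)).restrictScalars K' ⊓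
        freeDegPiece K' n r f m =
      span K' (extendCoeff K' '' (((span (MvPolynomial (Fin (n + 1)) K) G).restrictScalars K ⊓
        freeDegPiece K n r f m : Submodule K (Fin r → MvPolynomial (Fin (n + 1)) K)) :
          Set (Fin r → MvPolynomial (Fin (n + 1)) K))) := by
  refine le_antisymm ?_ (span_le.2 ?_)
  · rintro x ⟨hxN, hx⟩
    have hproj := gradedProj_of_mem hx m
    rw [if_pos rfl] at hproj
    rw [← hproj]
    refine span_restrictScalars_le_of_monomial_smul_mem (A := (span K' _).comap
      (gradedProj K' n f m)) ?_ hxN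
    rintro _ ⟨g, hg, rfl⟩ α c
    obtain ⟨k, hk⟩ := hG g hg
    rw [mem_comap, gradedProj_of_mem
      (monomial_smul_mem_freeDegPiece (extendCoeff_mem_freeDegPiece K' hk) α c)]
    split_ifs with hkm
    · rw [show monomial α c • extendCoeff K' g = c • extendCoeff K' (monomial α (1 : K) • g) by
        rw [extendCoeff_smul, map_monomial, map_one, ← smul_assoc, smul_monomial, smul_eq_mul,
          mul_one]]
      have hmem : monomial α (1 : K) • g ∈ (span (MvPolynomial (Fin (n + 1)) K) G).restrictScalars K ⊓
          freeDegPiece K n r f m := by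
        refine ⟨(span (MvPolynomial (Fin (n + 1)) K) G).smul_mem _ (subset_span hg), ?_⟩
        rw [hkm]
        exact monomial_smul_mem_freeDegPiece hk α 1
      exact smul_mem _ c (subset_span (Set.mem_image_of_mem _ hmem))
    · exact zero_mem _
  · rintro _ ⟨x, ⟨hxN, hx⟩, rfl⟩
    refine ⟨?_, extendCoeff_mem_freeDegPiece K' hx⟩
    refine span_restrictScalars_le_of_monomial_smul_mem (A := ((span (MvPolynomial (Fin (n + 1)) K')
      (extendCoeff K' '' G)).restrictScalars K).comap (extendCoeff K')) (fun g hg α c => ?_) hxN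
    rw [mem_comap, extendCoeff_smul]
    exact (span (MvPolynomial (Fin (n + 1)) K') _).smul_mem _ (subset_span ⟨g, hg, rfl⟩)

theorem freeDegPiece_extendCoeff (m : ℤ) :
    freeDegPiece K' n r f m =
      span K' (extendCoeff K' ''
        (freeDegPiece K n r f m : Set (Fin r → MvPolynomial (Fin (n + 1)) K))) := by
  have h := span_extendCoeff_inf_freeDegPiece K' (f := f)
    (G := Set.range (Pi.basisFun (MvPolynomial (Fin (n + 1)) K) (Fin r))) (by
      rintro _ ⟨i, rfl⟩
      refine ⟨f i, mem_freeDegPiece.2 fun j => ?_⟩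
      rw [Pi.basisFun_apply]
      obtain rfl | hj := eq_or_ne j i
      · rw [Pi.single_eq_same, sub_self, degPiece_of_nonneg le_rfl]
        exact isHomogeneous_one _ _
      · rw [Pi.single_eq_of_ne hj]
        exact zero_mem _) m
  have himage : extendCoeff K' '' Set.range (Pi.basisFun (MvPolynomial (Fin (n + 1)) K) (Fin r)) =
      Set.range (Pi.basisFun (MvPolynomial (Fin (n + 1)) K') (Fin r)) := by
    rw [← Set.range_comp]
    congr 1
    funext i j
    simp only [Function.comp_apply, extendCoeff_apply, Pi.basisFun_apply, Pi.single_apply]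
    split_ifs <;> simp
  rwa [himage, Basis.span_eq, Basis.span_eq, restrictScalars_top, restrictScalars_top, top_inf_eq,
    top_inf_eq] at h

theorem finiteDimensional_freeDegPiece (m : ℤ) :
    FiniteDimensional K (freeDegPiece K n r f m) := by
  have (i : Fin r) : FiniteDimensional K (degPiece K n (m - f i)) := by
    rcases lt_or_ge (m - f i) 0 with h | h
    · rw [degPiece_of_neg h]
      infer_instance
    · rw [degPiece_of_nonneg h]
      exact Module.Finite.iff_fg.2 (homogeneousSubmodule_fg _ _ _)
  let g : freeDegPiece K n r f m →ₗ[K] ∀ i, degPiece K n (m - f i) :=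
    LinearMap.pi fun i => (LinearMap.proj i ∘ₗ Submodule.subtype _).codRestrict _
      fun x => mem_freeDegPiece.1 x.2 i
  refine Module.Finite.of_injective g fun x y hxy => ?_
  ext1
  funext i
  exact congrArg Subtype.val (congrFun hxy i)

theorem hilbFn_extendCoeff {G : Set (Fin r → MvPolynomial (Fin (n + 1)) K)}
    (hG : ∀ g ∈ G, ∃ k, g ∈ freeDegPiece K n r f k) (m : ℤ) :
    hilbFn K' n r f (span (MvPolynomial (Fin (n + 1)) K') (extendCoeff K' '' G)) m =
      hilbFn K n r f (span (MvPolynomial (Fin (n + 1)) K) G) m := by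
  have := finiteDimensional_freeDegPiece (K := K) (n := n) (f := f) m
  have := Submodule.finiteDimensional_of_le (inf_le_right :
    (span (MvPolynomial (Fin (n + 1)) K) G).restrictScalars K ⊓ freeDegPiece K n r f m ≤ _)
  rw [hilbFn, hilbFn, span_extendCoeff_inf_freeDegPiece K' hG, freeDegPiece_extendCoeff (K := K) K',
    finrank_span_extendCoeff, finrank_span_extendCoeff]

end BaseChange

/-- **Gasharov's persistence for modules.** Let `S = k[x_0, …, x_n]`,
`F = S e_1 ⊕ ⋯ ⊕ S e_r` a free graded module whose generators have degrees `f i ≤ l`, `N` a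
graded submodule of `F`, and `M = F/N`. Let `p ≥ 0` and `d ≥ p + l + 1`. If `N` is generated
in degrees at most `d` and `H(M, d+1) = H(M, d)^{⟨d - l - p⟩}`, then
`H(M, d+2) = H(M, d+1)^{⟨d + 1 - l - p⟩}`. -/
theorem gasharov_persistence (K : Type) [Field K] (n r : ℕ)
    (f : Fin r → ℤ) (l : ℤ) (hfl : ∀ i, f i ≤ l)
    (N : Submodule (MvPolynomial (Fin (n+1)) K) (Fin r → MvPolynomial (Fin (n+1)) K))
    (p d : ℤ) (hp : 0 ≤ p) (hd : p + l + 1 ≤ d)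
    (hNgen : ∃ G : Set (Fin r → MvPolynomial (Fin (n+1)) K),
      N = Submodule.span (MvPolynomial (Fin (n+1)) K) G ∧
        ∀ g ∈ G, ∃ m : ℤ, m ≤ d ∧ g ∈ freeDegPiece K n r f m)
    (hpers : hilbFn K n r f N (d + 1) =
      macaulayTransform (d - l - p).toNat (hilbFn K n r f N d)) :
    hilbFn K n r f N (d + 2) =
      macaulayTransform (d + 1 - l - p).toNat (hilbFn K n r f N (d + 1)) := by
  obtain ⟨G, rfl, hG⟩ := hNgen
  have hbc := hilbFn_extendCoeff (AlgebraicClosure K) (f := f) (G := G) fun g hg =>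
    (hG g hg).imp fun _ => And.right
  rw [← hbc, ← hbc, sub_sub] at hpers ⊢
  refine hilbFn_persistence_of_infinite (fun i => (hfl i).trans (by omega)) (by omega) ?_ hpers
  rintro _ ⟨g, hg, rfl⟩
  obtain ⟨k, hkd, hk⟩ := hG g hg
  exact ⟨k, hkd, extendCoeff_mem_freeDegPiece _ hk⟩
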